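/- arXiv:2210.10029 — 2 statements merged into one kernel-verified Lean document; each statement's English description precedes it below -/
import Mathlib

section
/- Let τ > 0 and δ > 0 with τδ ≥ 2, and let N ⊆ ℝ be a measurable set. Then for every G in the Paley–Wiener space B¹(τ), one has ∫_N |G(x)| dx ≤ (5/2)·(τ + δ⁻¹) · (sup_{x∈ℝ} |N ∩ [x, x+δ]|) · ‖G‖_{L¹(ℝ)}, where |·| denotes Lebesgue measure. -/
open MeasureTheory Real Set FourierTransform

/-- The Paley–Wiener space `B¹(τ)`: integrable functions on `ℝ` whose (distributional)
Fourier transform — which for `L¹` functions is the continuous function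
`𝓕 G t = ∫ x, G x * exp (-2πixt)` — is supported in `[-τ, τ]`. -/
def PaleyWiener1 (τ : ℝ) (G : ℝ → ℂ) : Prop :=
  Integrable G ∧ ∀ t : ℝ, t ∉ Set.Icc (-τ) τ → 𝓕 G t = 0

theorem integral_fourier_mul_eq_integral_mul_fourier {f g : ℝ → ℂ} (hf : Integrable f)
    (hg : Integrable g) : ∫ t, 𝓕 f t * g t = ∫ x, f x * 𝓕 g x := by
  simpa using! VectorFourier.integral_bilin_fourierIntegral_eq_flip (ContinuousLinearMap.mul ℂ ℂ)
    (L := innerₗ ℝ) continuous_fourierChar continuous_inner hf hg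

theorem MeasureTheory.Integrable.continuous_fourier {f : ℝ → ℂ} (hf : Integrable f) :
    Continuous (𝓕 f) :=
  VectorFourier.fourierIntegral_continuous continuous_fourierChar continuous_inner hf

theorem fourier_fourierChar_mul (f : ℝ → ℂ) (x y : ℝ) :
    𝓕 (fun t ↦ (𝐞 (t * x) : ℂ) * f t) y = 𝓕 f (y - x) := by
  simp only [fourier_real_eq]
  refine integral_congr_ae (.of_forall fun t ↦ ?_)
  simp only [Circle.smul_def, smul_eq_mul]
  rw [← mul_assoc, ← Circle.coe_mul, ← AddChar.map_add_eq_mul]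
  ring_nf

theorem MeasureTheory.Integrable.fourierChar_mul {f : ℝ → ℂ} (hf : Integrable f) (x : ℝ) :
    Integrable fun t ↦ (𝐞 (t * x) : ℂ) * f t := by
  refine hf.bdd_mul (c := 1) ?_ (.of_forall fun t ↦ (Circle.norm_coe _).le)
  exact Continuous.aestronglyMeasurable (by fun_prop)

/-- Fourier inversion in `L¹`, almost everywhere. -/
theorem MeasureTheory.Integrable.ae_eq_fourierInv_fourier {f : ℝ → ℂ} (hf : Integrable f)
    (hf' : Integrable (𝓕 f)) : f =ᵐ[volume] 𝓕⁻ (𝓕 f) := by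
  have hcont : Continuous (𝓕⁻ (𝓕 f)) := by
    rw [funext (fourierInv_eq_fourier_neg (𝓕 f))]
    exact hf'.continuous_fourier.comp continuous_neg
  refine ae_eq_of_integral_contDiff_smul_eq hf.locallyIntegrable hcont.locallyIntegrable ?_
  intro g hg hgc
  have hg₁ : HasCompactSupport (Complex.ofRealCLM ∘ g) := hgc.comp_left rfl
  have hg₂ : ContDiff ℝ (⊤ : ℕ∞) (Complex.ofRealCLM ∘ g) := Complex.ofRealCLM.contDiff.comp hg
  let ψ := hg₁.toSchwartzMap hg₂
  have hψ : ∀ x, 𝓕 (𝓕⁻ ψ : SchwartzMap ℝ ℂ) x = (g x : ℂ) := by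
    intro x
    rw [FourierTransform.fourier_fourierInv_eq]; rfl
  have hψ' : ∀ x, 𝓕 (ψ : ℝ → ℂ) (-x) = (𝓕⁻ ψ : SchwartzMap ℝ ℂ) x := by
    intro x
    rw [SchwartzMap.fourierInv_coe, fourierInv_eq_fourier_neg]
  have h1 := integral_fourier_mul_eq_integral_mul_fourier hf (𝓕⁻ ψ : SchwartzMap ℝ ℂ).integrable
  have h2 := integral_fourier_mul_eq_integral_mul_fourier hf'.comp_neg ψ.integrable
  calc ∫ x, g x • f x = ∫ x, f x * 𝓕 (𝓕⁻ ψ : SchwartzMap ℝ ℂ) x := by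
        simp only [hψ, Complex.real_smul, mul_comm]
    _ = ∫ t, 𝓕 f t * (𝓕⁻ ψ : SchwartzMap ℝ ℂ) t := h1.symm
    _ = ∫ t, 𝓕 f (-t) * 𝓕 (ψ : ℝ → ℂ) t := by
        rw [← integral_neg_eq_self]
        simp only [← hψ', neg_neg]
    _ = ∫ x, 𝓕 (fun t ↦ 𝓕 f (-t)) x * ψ x := h2.symm
    _ = ∫ x, g x • 𝓕⁻ (𝓕 f) x := by
        rw [fourierInv_eq_fourier_comp_neg]
        refine integral_congr_ae (.of_forall fun x ↦ ?_)
        simp only [Complex.real_smul]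
        rw [mul_comm]; rfl

/-- A function whose spectrum lies where `𝓕 T` is `1` is reproduced by convolution with `𝓕 T`. -/
theorem ae_eq_integral_mul_fourier_sub {f T : ℝ → ℂ} (hf : Integrable f)
    (hf' : Integrable (𝓕 f)) (hT : Integrable T) (h : ∀ t, 𝓕 f t * T t = 𝓕 f t) :
    f =ᵐ[volume] fun x ↦ ∫ y, f y * 𝓕 T (y - x) := by
  filter_upwards [hf.ae_eq_fourierInv_fourier hf'] with x hx
  rw [hx]
  simp only [← fourier_fourierChar_mul T x]
  rw [← integral_fourier_mul_eq_integral_mul_fourier hf (hT.fourierChar_mul x),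
    fourierInv_eq]
  refine integral_congr_ae (.of_forall fun t ↦ ?_)
  simp only [Circle.smul_def, smul_eq_mul]
  rw [mul_left_comm, h]
  simp [mul_comm]

/-- The tent function of half-width `a`. -/
noncomputable def tent (a t : ℝ) : ℝ := max (a - |t|) 0

theorem continuous_tent (a : ℝ) : Continuous (tent a) := by unfold tent; fun_prop

theorem tent_eq_zero {a t : ℝ} (h : a ≤ |t|) : tent a t = 0 := max_eq_right (by linarith)

theorem tent_eq_sub {a t : ℝ} (h : |t| ≤ a) : tent a t = a - |t| := max_eq_left (by linarith)

theorem hasCompactSupport_tent (a : ℝ) : HasCompactSupport (tent a) := by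
  refine HasCompactSupport.of_support_subset_isCompact (isCompact_Icc (a := -a) (b := a)) ?_
  intro t ht
  by_contra h
  exact ht (tent_eq_zero (by rw [mem_Icc, ← abs_le] at h; linarith))

theorem integrable_tent (a : ℝ) : Integrable (tent a) :=
  (continuous_tent a).integrable_of_hasCompactSupport (hasCompactSupport_tent a)

theorem integral_tent_smul {E : Type*} [NormedAddCommGroup E] [NormedSpace ℝ E] {a : ℝ}
    (ha : 0 ≤ a) {φ : ℝ → E} (hφ : Continuous φ) :
    ∫ t, tent a t • φ t = ∫ t in 0..a, (a - t) • (φ t + φ (-t)) := by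
  have h : ∫ t, tent a t • φ t = ∫ t in (-a)..a, tent a t • φ t := by
    rw [intervalIntegral.integral_of_le (by linarith), setIntegral_eq_integral_of_forall_compl_eq_zero]
    intro t ht
    rw [tent_eq_zero, zero_smul]
    by_contra! hlt
    rw [abs_lt] at hlt
    exact ht ⟨hlt.1, hlt.2.le⟩
  have hc : Continuous fun t ↦ tent a t • φ t := (continuous_tent a).smul hφ
  have hc' : Continuous fun t ↦ tent a (-t) • φ (-t) := hc.comp continuous_neg
  rw [h, ← intervalIntegral.integral_add_adjacent_intervals (b := 0)
    (hc.intervalIntegrable _ _) (hc.intervalIntegrable _ _), add_comm]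
  have h2 : ∫ t in (-a)..0, tent a t • φ t = ∫ t in 0..a, tent a (-t) • φ (-t) := by
    rw [intervalIntegral.integral_comp_neg (fun t ↦ tent a t • φ t), neg_zero]
  rw [h2, ← intervalIntegral.integral_add (hc.intervalIntegrable _ _) (hc'.intervalIntegrable _ _)]
  refine intervalIntegral.integral_congr fun t ht ↦ ?_
  rw [uIcc_of_le ha] at ht
  have e : |t| = t := abs_of_nonneg ht.1
  rw [tent_eq_sub (by linarith [ht.2]), tent_eq_sub (by rw [abs_neg]; linarith [ht.2]), abs_neg, e,
    smul_add]

theorem integral_tent {a : ℝ} (ha : 0 ≤ a) : ∫ t, tent a t = a ^ 2 := by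
  have h := integral_tent_smul ha (continuous_const (y := (1 : ℝ)))
  simp only [smul_eq_mul, mul_one] at h
  rw [h, intervalIntegral.integral_mul_const, intervalIntegral.integral_sub (by simp) (by simp)]
  simp
  ring

theorem fourier_tent {a : ℝ} (ha : 0 ≤ a) {u : ℝ} (hu : u ≠ 0) :
    𝓕 (fun t ↦ (tent a t : ℂ)) u = ((sin (π * a * u) / (π * u)) ^ 2 : ℝ) := by
  have h1 : 𝓕 (fun t ↦ (tent a t : ℂ)) u = ∫ t, tent a t • (𝐞 (-(t * u)) : ℂ) := by
    rw [fourier_real_eq]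
    refine integral_congr_ae (.of_forall fun t ↦ ?_)
    simp [Circle.smul_def, mul_comm]
  set c := 2 * π * u with hc
  have hc0 : c ≠ 0 := by positivity
  have h2 : ∀ t : ℝ, (𝐞 (-(t * u)) : ℂ) + (𝐞 (-(-t * u)) : ℂ) = ((2 * cos (c * t) : ℝ) : ℂ) := by
    intro t
    simp only [fourierChar_apply]
    push_cast
    rw [Complex.two_cos, add_comm]
    congr 2 <;> simp only [hc] <;> push_cast <;> ring
  rw [h1, integral_tent_smul ha (by fun_prop)]
  simp only [h2]
  simp only [Complex.real_smul, ← Complex.ofReal_mul]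
  rw [intervalIntegral.integral_ofReal]
  congr 1
  have h3 : ∀ t ∈ uIcc 0 a, HasDerivAt (fun t ↦ 2 * ((a - t) * (sin (c * t) / c) - cos (c * t) / c ^ 2))
      ((a - t) * (2 * cos (c * t))) t := by
    intro t _
    have hl : HasDerivAt (fun t ↦ c * t) c t := by simpa using (hasDerivAt_id t).const_mul c
    have := ((((hasDerivAt_id t).const_sub a).mul (hl.sin.div_const c)).sub
      (hl.cos.div_const (c ^ 2))).const_mul 2
    convert! this using 1
    simp only [id]
    field_simp
    ring
  rw [intervalIntegral.integral_eq_sub_of_hasDerivAt h3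
    (Continuous.intervalIntegrable (by fun_prop) _ _)]
  have h4 : cos (c * a) = 1 - 2 * sin (π * a * u) ^ 2 := by
    rw [← cos_two_mul_eq_one_sub]
    congr 1
    rw [hc]; ring
  simp only [h4, mul_zero, sin_zero, cos_zero, sub_self, zero_mul, zero_div, zero_sub]
  rw [hc]
  field_simp
  ring

/-- The trapezoid equal to `1` on `[-τ, τ]` and vanishing outside `[-τ - η, τ + η]`. -/
noncomputable def trapezoid (τ η t : ℝ) : ℝ := η⁻¹ * (tent (τ + η) t - tent τ t)

theorem trapezoid_nonneg {τ η : ℝ} (hη : 0 ≤ η) (t : ℝ) : 0 ≤ trapezoid τ η t :=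
  mul_nonneg (inv_nonneg.2 hη) (sub_nonneg.2 (max_le_max_right _ (by linarith)))

theorem trapezoid_eq_one {τ η t : ℝ} (hη : 0 < η) (ht : |t| ≤ τ) : trapezoid τ η t = 1 := by
  rw [trapezoid, tent_eq_sub (by linarith), tent_eq_sub ht]
  field_simp
  ring

theorem integrable_trapezoid (τ η : ℝ) : Integrable (trapezoid τ η) :=
  ((integrable_tent _).sub (integrable_tent _)).const_mul _

theorem integral_trapezoid {τ η : ℝ} (hτ : 0 ≤ τ) (hη : 0 < η) :
    ∫ t, trapezoid τ η t = 2 * τ + η := by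
  simp only [trapezoid]
  rw [integral_const_mul, integral_sub (integrable_tent _) (integrable_tent _),
    integral_tent hτ, integral_tent (by positivity)]
  field_simp
  ring

theorem norm_fourier_trapezoid_le {τ η : ℝ} (hτ : 0 ≤ τ) (hη : 0 < η) (u : ℝ) :
    ‖𝓕 (fun t ↦ (trapezoid τ η t : ℂ)) u‖ ≤ 2 * τ + η := by
  rw [fourier_real_eq, ← integral_trapezoid hτ hη]
  refine (norm_integral_le_integral_norm _).trans_eq ?_
  simp [Circle.norm_smul, abs_of_nonneg (trapezoid_nonneg hη.le _)]

theorem norm_fourier_trapezoid_le_div_sq {τ η : ℝ} (hτ : 0 ≤ τ) (hη : 0 < η) {u : ℝ}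
    (hu : u ≠ 0) : ‖𝓕 (fun t ↦ (trapezoid τ η t : ℂ)) u‖ ≤ η⁻¹ / (π * u) ^ 2 := by
  have hi (a : ℝ) : Integrable fun t ↦ 𝐞 (-(t * u)) • (tent a t : ℂ) := by
    simpa only [Circle.smul_def, smul_eq_mul, mul_neg] using!
      (integrable_tent a).ofReal.fourierChar_mul (-u)
  have h : 𝓕 (fun t ↦ (trapezoid τ η t : ℂ)) u =
      (η⁻¹ * ((sin (π * (τ + η) * u) / (π * u)) ^ 2 - (sin (π * τ * u) / (π * u)) ^ 2) : ℝ) := by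
    rw [Complex.ofReal_mul, Complex.ofReal_sub, ← fourier_tent hτ hu,
      ← fourier_tent (add_nonneg hτ hη.le) hu]
    simp only [fourier_real_eq]
    rw [← integral_sub (hi _) (hi _), ← integral_const_mul]
    refine integral_congr_ae (.of_forall fun t ↦ ?_)
    simp only [trapezoid, Circle.smul_def, smul_eq_mul]
    push_cast
    ring
  rw [h, Complex.norm_real, norm_eq_abs, abs_mul, abs_of_pos (inv_pos.2 hη), div_pow, div_pow,
    ← sub_div, abs_div, abs_of_nonneg (sq_nonneg (π * u)), mul_div_assoc']
  gcongr
  refine mul_le_of_le_one_right (by positivity) (abs_le.2 ⟨?_, ?_⟩) <;>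
  nlinarith [sin_sq_le_one (π * (τ + η) * u), sin_sq_le_one (π * τ * u),
    sq_nonneg (sin (π * (τ + η) * u)), sq_nonneg (sin (π * τ * u))]

theorem hasSum_int_one_div_sq : HasSum (fun k : ℤ ↦ 1 / (k : ℝ) ^ 2) (π ^ 2 / 3) := by
  have h := HasSum.of_nat_of_neg (f := fun k : ℤ ↦ 1 / (k : ℝ) ^ 2)
    (by simpa using hasSum_zeta_two) (by simpa using hasSum_zeta_two)
  convert! h using 1
  simp
  ring

open scoped ENNReal

/-- Splitting `N` into blocks of length `δ` centred at `y + k δ`. -/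
theorem setLIntegral_le_tsum_mul {N : Set ℝ} (hN : MeasurableSet N) {δ : ℝ} (hδ : 0 < δ)
    {ρ : ℝ≥0∞} (hρ : ∀ x, volume (N ∩ Icc x (x + δ)) ≤ ρ) (y : ℝ) {f : ℝ → ℝ≥0∞} {c : ℤ → ℝ≥0∞}
    (hf : ∀ x, ∀ k : ℤ, |x - y - k * δ| ≤ δ / 2 → f x ≤ c k) :
    ∫⁻ x in N, f x ≤ (∑' k, c k) * ρ := by
  let B : ℤ → Set ℝ := fun k ↦ N ∩ Icc (y + k * δ - δ / 2) (y + k * δ - δ / 2 + δ)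
  have hcover : N ⊆ ⋃ k, B k := by
    intro x hx
    have h := abs_sub_round ((x - y) / δ)
    have hx' : x - y = (x - y) / δ * δ := by field_simp
    rw [abs_le] at h
    refine mem_iUnion.2 ⟨round ((x - y) / δ), hx, ?_, ?_⟩ <;> nlinarith
  calc ∫⁻ x in N, f x ≤ ∫⁻ x in ⋃ k, B k, f x := lintegral_mono_set hcover
    _ ≤ ∑' k, ∫⁻ x in B k, f x := lintegral_iUnion_le _ _
    _ ≤ ∑' k, c k * ρ := by
      refine ENNReal.tsum_le_tsum fun k ↦ ?_
      calc ∫⁻ x in B k, f x ≤ ∫⁻ _ in B k, c k := by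
            refine setLIntegral_mono' (hN.inter measurableSet_Icc) fun x hx ↦ hf x k ?_
            rw [abs_le]
            constructor <;> linarith [hx.2.1, hx.2.2]
        _ = c k * volume (B k) := setLIntegral_const _ _
        _ ≤ c k * ρ := by gcongr; exact hρ _
    _ = (∑' k, c k) * ρ := ENNReal.tsum_mul_right

theorem setLIntegral_enorm_fourier_trapezoid_le {N : Set ℝ} (hN : MeasurableSet N) {τ δ : ℝ}
    (hτ : 0 ≤ τ) (hδ : 0 < δ) {ρ : ℝ≥0∞} (hρ : ∀ x, volume (N ∩ Icc x (x + δ)) ≤ ρ) (y : ℝ) :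
    ∫⁻ x in N, ‖𝓕 (fun t ↦ (trapezoid τ δ⁻¹ t : ℂ)) (y - x)‖ₑ ≤
      ENNReal.ofReal (2 * τ + 7 / 3 * δ⁻¹) * ρ := by
  let c : ℤ → ℝ := fun k ↦
    (if k = 0 then 2 * τ + δ⁻¹ else 0) + 4 * δ⁻¹ / π ^ 2 * (1 / (k : ℝ) ^ 2)
  have hc : HasSum c (2 * τ + 7 / 3 * δ⁻¹) := by
    convert! (hasSum_ite_eq (0 : ℤ) (2 * τ + δ⁻¹)).add
      (hasSum_int_one_div_sq.mul_left (4 * δ⁻¹ / π ^ 2)) using 1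
    field_simp
    ring
  have hc0 (k : ℤ) : 0 ≤ c k := by simp only [c]; positivity
  rw [← hc.tsum_eq, ENNReal.ofReal_tsum_of_nonneg hc0 hc.summable]
  refine setLIntegral_le_tsum_mul hN hδ hρ y fun x k hx ↦ ?_
  rw [← ofReal_norm]
  refine ENNReal.ofReal_le_ofReal ?_
  rcases eq_or_ne k 0 with rfl | hk
  · simpa [c] using norm_fourier_trapezoid_le hτ (inv_pos.2 hδ) (y - x)
  have hk1 : (1 : ℝ) ≤ |(k : ℝ)| := by exact_mod_cast Int.one_le_abs hk
  have hfar : |(k : ℝ)| * δ / 2 ≤ |y - x| := by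
    have h1 := abs_sub_abs_le_abs_sub ((k : ℝ) * δ) (x - y)
    rw [abs_sub_comm _ (x - y), abs_mul, abs_of_pos hδ, abs_sub_comm x y] at h1
    nlinarith
  have hne : y - x ≠ 0 := abs_pos.1 (lt_of_lt_of_le (by positivity) hfar)
  refine (norm_fourier_trapezoid_le_div_sq hτ (inv_pos.2 hδ) hne).trans ?_
  have hsq : (|(k : ℝ)| * δ / 2) ^ 2 ≤ |y - x| ^ 2 := by gcongr
  rw [sq_abs, div_pow, mul_pow, sq_abs] at hsq
  have hk0 : (k : ℝ) ≠ 0 := by exact_mod_cast hk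
  calc δ⁻¹⁻¹ / (π * (y - x)) ^ 2 = δ / (π ^ 2 * (y - x) ^ 2) := by rw [inv_inv, mul_pow]
    _ ≤ δ / (π ^ 2 * ((k : ℝ) ^ 2 * δ ^ 2 / 2 ^ 2)) := by gcongr
    _ = c k := by
      simp only [c, if_neg hk]
      field_simp
      ring

theorem PaleyWiener1.integrable_fourier {τ : ℝ} {G : ℝ → ℂ} (hG : PaleyWiener1 τ G) :
    Integrable (𝓕 G) := by
  refine hG.1.continuous_fourier.integrable_of_hasCompactSupport ?_
  refine HasCompactSupport.of_support_subset_isCompact (isCompact_Icc (a := -τ) (b := τ)) ?_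
  intro t ht
  by_contra h
  exact ht (hG.2 t h)

theorem PaleyWiener1.setLIntegral_enorm_le {τ δ : ℝ} (hτ : 0 ≤ τ) (hδ : 0 < δ) {N : Set ℝ}
    (hN : MeasurableSet N) {G : ℝ → ℂ} (hG : PaleyWiener1 τ G) {ρ : ℝ≥0∞}
    (hρ : ∀ x, volume (N ∩ Icc x (x + δ)) ≤ ρ) :
    ∫⁻ x in N, ‖G x‖ₑ ≤ ENNReal.ofReal (2 * τ + 7 / 3 * δ⁻¹) * ρ * ∫⁻ x, ‖G x‖ₑ := by
  set T : ℝ → ℂ := fun t ↦ (trapezoid τ δ⁻¹ t : ℂ) with hT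
  have hTi : Integrable T := (integrable_trapezoid τ δ⁻¹).ofReal
  have hrep := ae_eq_integral_mul_fourier_sub hG.1 hG.integrable_fourier hTi fun t ↦ by
    by_cases ht : t ∈ Icc (-τ) τ
    · rw [hT]
      simp [trapezoid_eq_one (inv_pos.2 hδ) (abs_le.2 ht)]
    · rw [hG.2 t ht, zero_mul]
  have hK : Continuous (𝓕 T) := hTi.continuous_fourier
  have hmeas : AEMeasurable (Function.uncurry fun x y ↦ ‖G y‖ₑ * ‖𝓕 T (y - x)‖ₑ)
      ((volume.restrict N).prod volume) := by
    refine AEMeasurable.mul hG.1.1.enorm.comp_snd ?_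
    exact (hK.comp (continuous_snd.sub continuous_fst)).enorm.measurable.aemeasurable
  calc ∫⁻ x in N, ‖G x‖ₑ = ∫⁻ x in N, ‖∫ y, G y * 𝓕 T (y - x)‖ₑ := by
        refine lintegral_congr_ae (ae_restrict_of_ae ?_)
        filter_upwards [hrep] with x hx
        rw [← hx]
    _ ≤ ∫⁻ x in N, ∫⁻ y, ‖G y‖ₑ * ‖𝓕 T (y - x)‖ₑ := by
        refine lintegral_mono fun x ↦ (enorm_integral_le_lintegral_enorm _).trans_eq ?_
        simp only [enorm_mul]
    _ = ∫⁻ y, ∫⁻ x in N, ‖G y‖ₑ * ‖𝓕 T (y - x)‖ₑ := lintegral_lintegral_swap hmeas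
    _ = ∫⁻ y, ‖G y‖ₑ * ∫⁻ x in N, ‖𝓕 T (y - x)‖ₑ := by
        refine lintegral_congr fun y ↦ lintegral_const_mul' _ _ enorm_ne_top
    _ ≤ ∫⁻ y, ‖G y‖ₑ * (ENNReal.ofReal (2 * τ + 7 / 3 * δ⁻¹) * ρ) := by
        gcongr with y
        exact setLIntegral_enorm_fourier_trapezoid_le hN hτ hδ hρ y
    _ = _ := by
        rw [lintegral_mul_const'' _ hG.1.1.enorm, mul_comm]

theorem donoho_logan_large_tau_delta (τ δ : ℝ) (hτ : 0 < τ) (hδ : 0 < δ) (hτδ : 2 ≤ τ * δ)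
    (N : Set ℝ) (hN : MeasurableSet N) (G : ℝ → ℂ) (hG : PaleyWiener1 τ G) :
    ∫ x in N, ‖G x‖ ≤ (5 / 2) * (τ + δ⁻¹) *
      (⨆ x : ℝ, (volume (N ∩ Set.Icc x (x + δ))).toReal) * ∫ x : ℝ, ‖G x‖ := by
  set ρ := ⨆ x : ℝ, (volume (N ∩ Set.Icc x (x + δ))).toReal
  have hfin (x : ℝ) : volume (N ∩ Icc x (x + δ)) ≤ ENNReal.ofReal δ :=
    (measure_mono inter_subset_right).trans_eq (by simp)
  have hbdd : BddAbove (range fun x : ℝ ↦ (volume (N ∩ Icc x (x + δ))).toReal) :=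
    ⟨δ, by rintro _ ⟨x, rfl⟩; exact ENNReal.toReal_le_of_le_ofReal hδ.le (hfin x)⟩
  have hρ0 : 0 ≤ ρ := iSup_nonneg fun x ↦ ENNReal.toReal_nonneg
  have hρ (x : ℝ) : volume (N ∩ Icc x (x + δ)) ≤ ENNReal.ofReal ρ := by
    rw [← ENNReal.ofReal_toReal ((hfin x).trans_lt ENNReal.ofReal_lt_top).ne]
    exact ENNReal.ofReal_le_ofReal (le_ciSup hbdd x)
  have h := hG.setLIntegral_enorm_le hτ.le hδ hN hρ
  have hδ' : 0 < δ⁻¹ := inv_pos.2 hδ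
  rw [← ofReal_integral_norm_eq_lintegral_enorm hG.1,
    ← ofReal_integral_norm_eq_lintegral_enorm hG.1.integrableOn,
    ← ENNReal.ofReal_mul (by positivity), ← ENNReal.ofReal_mul (by positivity),
    ENNReal.ofReal_le_ofReal_iff (by positivity)] at h
  refine h.trans ?_
  gcongr
  linarith
end

section
/- For every τ ≥ 0, the supremum norm of g_τ is attained at the origin: sup_{x∈ℝ} |g_τ(x)| = g_τ(0) = 2τ + 1. -/
open MeasureTheory Real Set FourierTransform Filter Topology

/-- The auxiliary function `g_τ`, supported on `[-1,1]`, with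
`g_τ(x) = 2(1-|x|)(cos(2πτx) - cos(2π(τ+1)x))/(4π²x²)` for `0 < |x| ≤ 1` and the
continuous extension `g_τ(0) = 2τ + 1`. -/
noncomputable def gfun (τ : ℝ) (x : ℝ) : ℝ :=
  if x = 0 then 2 * τ + 1
  else if |x| ≤ 1 then
    2 * (1 - |x|) * (Real.cos (2 * π * τ * x) - Real.cos (2 * π * (τ + 1) * x)) /
      (4 * π ^ 2 * x ^ 2)
  else 0

/-- The Fourier transform `ĝ_τ(t) = ∫_{-1}^{1} g_τ(x) e^{-2πixt} dx`.  Since `g_τ` is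
real-valued, even and supported in `[-1,1]`, this equals the real-valued cosine
integral `∫ g_τ(x) cos(2πxt) dx` over `ℝ`, which we take as the definition. -/
noncomputable def ghat (τ : ℝ) (t : ℝ) : ℝ :=
  ∫ x : ℝ, gfun τ x * Real.cos (2 * π * x * t)

theorem abs_cos_sub_cos_le (τ x : ℝ) (hτ : 0 ≤ τ) :
    |Real.cos (2 * π * τ * x) - Real.cos (2 * π * (τ + 1) * x)| ≤
      2 * π ^ 2 * (2 * τ + 1) * x ^ 2 := by
  have key : Real.cos (2 * π * τ * x) - Real.cos (2 * π * (τ + 1) * x) =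
      2 * (Real.sin (π * (2 * τ + 1) * x) * Real.sin (π * x)) := by
    rw [Real.cos_sub_cos,
      show (2 * π * τ * x + 2 * π * (τ + 1) * x) / 2 = π * (2 * τ + 1) * x by ring,
      show (2 * π * τ * x - 2 * π * (τ + 1) * x) / 2 = -(π * x) by ring, Real.sin_neg]
    ring
  rw [key, abs_mul, abs_mul, abs_two]
  calc 2 * (|Real.sin (π * (2 * τ + 1) * x)| * |Real.sin (π * x)|)
      ≤ 2 * (|π * (2 * τ + 1) * x| * |π * x|) := by
        gcongr 2 * (?_ * ?_) <;> exact Real.abs_sin_le_abs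
    _ = 2 * π ^ 2 * (2 * τ + 1) * x ^ 2 := by
        rw [← abs_mul, abs_of_nonneg, ← sub_eq_zero]
        · ring
        · rw [show π * (2 * τ + 1) * x * (π * x) = π ^ 2 * (2 * τ + 1) * x ^ 2 by ring]
          positivity

theorem gfun_zero (τ : ℝ) : gfun τ 0 = 2 * τ + 1 := by
  simp [gfun]

theorem abs_gfun_le (τ x : ℝ) (hτ : 0 ≤ τ) : |gfun τ x| ≤ 2 * τ + 1 := by
  have hpos : 0 ≤ 2 * τ + 1 := by positivity
  unfold gfun
  split_ifs with h0 h1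
  · rw [abs_of_nonneg hpos]
  · have hden : 0 < 4 * π ^ 2 * x ^ 2 := by positivity
    have hx : 0 ≤ 1 - |x| := sub_nonneg.2 h1
    rw [abs_div, abs_of_pos hden, div_le_iff₀ hden, abs_mul,
      abs_of_nonneg (mul_nonneg zero_le_two hx)]
    have hx' : 2 * (1 - |x|) ≤ 2 := by linarith [abs_nonneg x]
    calc _ ≤ 2 * (2 * π ^ 2 * (2 * τ + 1) * x ^ 2) :=
          mul_le_mul hx' (abs_cos_sub_cos_le τ x hτ) (abs_nonneg _) zero_le_two
      _ = (2 * τ + 1) * (4 * π ^ 2 * x ^ 2) := by ring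
  · simpa using hpos

theorem gfun_sup_norm (τ : ℝ) (hτ : 0 ≤ τ) :
    (⨆ x : ℝ, |gfun τ x|) = gfun τ 0 ∧ gfun τ 0 = 2 * τ + 1 := by
  have hle (x : ℝ) : |gfun τ x| ≤ gfun τ 0 := (abs_gfun_le τ x hτ).trans_eq (gfun_zero τ).symm
  refine ⟨le_antisymm (ciSup_le hle) ?_, gfun_zero τ⟩
  exact (le_abs_self _).trans (le_ciSup (f := fun x ↦ |gfun τ x|) ⟨_, forall_mem_range.2 hle⟩ 0)
end
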